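/- arXiv:math/0208130 — 2 statements merged into one kernel-verified Lean document; each statement's English description precedes it below -/
import Mathlib

section
/- Let α be a real number with |α| < 1. Define T : ℓ²(ℕ, ℝ) → ℓ²(ℕ, ℝ) by (T f)(i) = Σ_{j ∈ ℕ} α^{|i−j|} f(j), and define B : ℓ²(ℕ, ℝ) → ℓ²(ℕ, ℝ) by (B f)(i) = (1/(1 − α²)) · [ (1 + α²) f(i) − α f(i+1) − α f(i−1) − α² f(0)·[i = 0] ], where the term f(i−1) is omitted when i = 0 (explicitly: (B f)(0) = (1/(1−α²))( f(0) − α f(1) ) and (B f)(i) = (1/(1−α²))( (1+α²) f(i) − α f(i−1) − α f(i+1) ) for i ≥ 1). Then T and B are well-defined bounded linear operators and B is a two-sided inverse of T: T(B f) = f and B(T f) = f for all f ∈ ℓ²(ℕ, ℝ). -/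
open scoped InnerProductSpace

/-- Dropping the first coordinate preserves square-summability. -/
theorem memℓp_two_tail (f : lp (fun _ : ℕ => ℝ) 2) :
    Memℓp (fun i : ℕ => f (i + 1)) 2 := by
  have h := (memℓp_gen_iff (p := 2) (by norm_num)).1 (lp.memℓp f)
  exact memℓp_gen ((summable_nat_add_iff 1).2 h)

/-- The backward (left) shift on `ℓ²(ℕ, ℝ)`. -/
noncomputable def leftShift : lp (fun _ : ℕ => ℝ) 2 →L[ℝ] lp (fun _ : ℕ => ℝ) 2 :=
  LinearMap.mkContinuous
    { toFun := fun f => ⟨fun i => f (i + 1), memℓp_two_tail f⟩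
      map_add' := fun _ _ => rfl
      map_smul' := fun _ _ => rfl } 1 (by
    intro f
    rw [one_mul]
    have hp : 0 < (2 : ENNReal).toReal := by norm_num
    refine lp.norm_le_of_forall_sum_le hp (norm_nonneg _) fun s => ?_
    have h := lp.sum_rpow_le_norm_rpow hp f (s.map (addRightEmbedding 1))
    rw [Finset.sum_map] at h
    exact h)

theorem leftShift_apply (f : lp (fun _ : ℕ => ℝ) 2) (i : ℕ) : leftShift f i = f (i + 1) := rfl

theorem norm_leftShift_le : ‖leftShift‖ ≤ 1 :=
  LinearMap.mkContinuous_norm_le _ zero_le_one _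

theorem inner_single_one_left (i : ℕ) (f : lp (fun _ : ℕ => ℝ) 2) :
    ⟪lp.single 2 i (1 : ℝ), f⟫_ℝ = f i := by
  rw [lp.inner_single_left]
  simp

theorem adjoint_leftShift_apply_zero (f : lp (fun _ : ℕ => ℝ) 2) :
    leftShift.adjoint f 0 = 0 := by
  rw [← inner_single_one_left 0, ContinuousLinearMap.adjoint_inner_right]
  have h : leftShift (lp.single 2 0 (1 : ℝ)) = 0 := by
    ext j
    simp [leftShift_apply, lp.single_apply]
  rw [h, inner_zero_left]

theorem adjoint_leftShift_apply_succ (f : lp (fun _ : ℕ => ℝ) 2) (i : ℕ) :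
    leftShift.adjoint f (i + 1) = f i := by
  rw [← inner_single_one_left (i + 1), ContinuousLinearMap.adjoint_inner_right]
  have h : leftShift (lp.single 2 (i + 1) (1 : ℝ)) = lp.single 2 i (1 : ℝ) := by
    ext j
    simp [leftShift_apply, lp.single_apply, Pi.single_apply]
  rw [h, inner_single_one_left]

/-- The tridiagonal operator `(1 - α²)⁻¹ (1 - αS)(1 - αS*)`, with `S*` the left shift. -/
noncomputable def kmsInverse (α : ℝ) : lp (fun _ : ℕ => ℝ) 2 →L[ℝ] lp (fun _ : ℕ => ℝ) 2 :=
  (1 / (1 - α ^ 2)) • ((1 - α • leftShift.adjoint) * (1 - α • leftShift))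

theorem kmsInverse_apply (α : ℝ) (f : lp (fun _ : ℕ => ℝ) 2) :
    kmsInverse α f = (1 / (1 - α ^ 2)) •
      ((f - α • leftShift f) - α • leftShift.adjoint (f - α • leftShift f)) := rfl

theorem kmsInverse_apply_zero (α : ℝ) (f : lp (fun _ : ℕ => ℝ) 2) :
    kmsInverse α f 0 = (1 / (1 - α ^ 2)) * (f 0 - α * f 1) := by
  change 1 / (1 - α ^ 2) * ((f 0 - α * f 1) -
    α * leftShift.adjoint (f - α • leftShift f) 0) = _
  rw [adjoint_leftShift_apply_zero, mul_zero, sub_zero]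

theorem kmsInverse_apply_succ (α : ℝ) (f : lp (fun _ : ℕ => ℝ) 2) (i : ℕ) :
    kmsInverse α f (i + 1) =
      (1 / (1 - α ^ 2)) * ((1 + α ^ 2) * f (i + 1) - α * f i - α * f (i + 2)) := by
  change 1 / (1 - α ^ 2) * ((f (i + 1) - α * f (i + 2)) -
    α * leftShift.adjoint (f - α • leftShift f) (i + 1)) = _
  rw [adjoint_leftShift_apply_succ]
  change 1 / (1 - α ^ 2) * ((f (i + 1) - α * f (i + 2)) - α * (f i - α * f (i + 1))) = _
  ring

theorem inner_kmsInverse_left (α : ℝ) (f g : lp (fun _ : ℕ => ℝ) 2) :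
    ⟪kmsInverse α f, g⟫_ℝ = ⟪f, kmsInverse α g⟫_ℝ := by
  simp only [kmsInverse_apply, real_inner_smul_left, real_inner_smul_right, inner_sub_left,
    inner_sub_right, ContinuousLinearMap.adjoint_inner_left,
    ContinuousLinearMap.adjoint_inner_right]
  ring

theorem isUnit_kmsInverse {α : ℝ} (hα : |α| < 1) : IsUnit (kmsInverse α) := by
  have hL : ‖α • leftShift‖ < 1 := by
    rw [norm_smul, Real.norm_eq_abs]
    exact (mul_le_of_le_one_right (abs_nonneg _) norm_leftShift_le).trans_lt hα
  have hR : ‖α • leftShift.adjoint‖ < 1 := by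
    rw [norm_smul, Real.norm_eq_abs, LinearIsometryEquiv.norm_map]
    exact (mul_le_of_le_one_right (abs_nonneg _) norm_leftShift_le).trans_lt hα
  have hc : 1 / (1 - α ^ 2) ≠ 0 :=
    one_div_ne_zero (sub_pos.2 ((sq_lt_one_iff_abs_lt_one α).2 hα)).ne'
  have h := (isUnit_one_sub_of_norm_lt_one hR).mul (isUnit_one_sub_of_norm_lt_one hL)
  exact h.smul (Units.mk0 _ hc)

theorem memℓp_pow_natAbs_sub {α : ℝ} (hα : |α| < 1) (i : ℕ) :
    Memℓp (fun j : ℕ => α ^ ((i : ℤ) - (j : ℤ)).natAbs) 2 := by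
  refine memℓp_gen ((summable_nat_add_iff i).1 ?_)
  have h := summable_geometric_of_lt_one (sq_nonneg α) ((sq_lt_one_iff_abs_lt_one α).2 hα)
  refine h.congr fun j => ?_
  have hj : ((i : ℤ) - ((j + i : ℕ) : ℤ)).natAbs = j := by omega
  rw [hj]
  rw [ENNReal.toReal_ofNat, Real.rpow_ofNat, Real.norm_eq_abs, sq_abs, pow_right_comm]

/-- The `i`-th row `j ↦ α ^ |i - j|` of the Kac–Murdock–Szegő matrix. -/
noncomputable def kmsRow {α : ℝ} (hα : |α| < 1) (i : ℕ) : lp (fun _ : ℕ => ℝ) 2 :=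
  ⟨fun j => α ^ ((i : ℤ) - (j : ℤ)).natAbs, memℓp_pow_natAbs_sub hα i⟩

theorem kmsRow_apply {α : ℝ} (hα : |α| < 1) (i j : ℕ) :
    kmsRow hα i j = α ^ ((i : ℤ) - (j : ℤ)).natAbs := rfl

theorem kmsRow_apply_add {α : ℝ} (hα : |α| < 1) (i d : ℕ) : kmsRow hα i (i + d) = α ^ d := by
  rw [kmsRow_apply]
  congr 1
  omega

theorem kmsRow_add_apply {α : ℝ} (hα : |α| < 1) (j d : ℕ) : kmsRow hα (j + d) j = α ^ d := by
  rw [kmsRow_apply]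
  congr 1
  omega

theorem kmsInverse_kmsRow {α : ℝ} (hα : |α| < 1) (i : ℕ) :
    kmsInverse α (kmsRow hα i) = lp.single 2 i (1 : ℝ) := by
  have hc : 1 - α ^ 2 ≠ 0 := (sub_pos.2 ((sq_lt_one_iff_abs_lt_one α).2 hα)).ne'
  ext j
  rw [lp.single_apply]
  rcases j with _ | j
  · rw [kmsInverse_apply_zero]
    rcases i with _ | i
    · have h0 := kmsRow_apply_add hα 0 0
      have h1 := kmsRow_apply_add hα 0 1
      simp only [Nat.zero_add] at h0 h1
      rw [h0, h1, Pi.single_eq_same]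
      field_simp
    · have h0 := kmsRow_add_apply hα 0 (i + 1)
      have h1 := kmsRow_add_apply hα 1 i
      rw [Nat.zero_add] at h0
      rw [Nat.add_comm 1 i] at h1
      rw [h0, h1, Pi.single_eq_of_ne (by omega)]
      ring
  · rw [kmsInverse_apply_succ]
    rcases lt_trichotomy i (j + 1) with h | rfl | h
    · obtain ⟨d, rfl⟩ := Nat.exists_eq_add_of_le (Nat.lt_succ_iff.1 h)
      rw [Pi.single_eq_of_ne (by omega), add_assoc, add_assoc]
      simp only [kmsRow_apply_add]
      ring
    · rw [Pi.single_eq_same, kmsRow_add_apply hα j 1, kmsRow_apply_add hα (j + 1) 0,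
        kmsRow_apply_add hα (j + 1) 1]
      field_simp
      ring
    · obtain ⟨d, rfl⟩ := Nat.exists_eq_add_of_le (Nat.succ_le_of_lt h)
      rw [Pi.single_eq_of_ne (by omega)]
      have h0 := kmsRow_add_apply hα j (d + 2)
      have h1 := kmsRow_add_apply hα (j + 1) (d + 1)
      have h2 := kmsRow_add_apply hα (j + 2) d
      rw [show j + (d + 2) = (j + 1).succ + d by omega] at h0
      rw [show j + 1 + (d + 1) = (j + 1).succ + d by omega] at h1
      rw [show j + 2 + d = (j + 1).succ + d by omega] at h2
      rw [h0, h1, h2]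
      ring

theorem hasSum_kmsRow_mul {α : ℝ} (hα : |α| < 1) (f : lp (fun _ : ℕ => ℝ) 2) (i : ℕ) :
    HasSum (fun j : ℕ => α ^ ((i : ℤ) - (j : ℤ)).natAbs * f j) ⟪kmsRow hα i, f⟫_ℝ := by
  refine (lp.hasSum_inner (𝕜 := ℝ) (kmsRow hα i) f).congr_fun fun j => ?_
  simp [kmsRow_apply, mul_comm]

/-- For `|α| < 1`, the Kac–Murdock–Szegő Toeplitz operator
`(T f)(i) = Σ_j α^{|i−j|} f(j)` on `ℓ²(ℕ, ℝ)` and the operator `B` with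
`(B f)(0) = (1/(1−α²))(f(0) − αf(1))` and
`(B f)(i) = (1/(1−α²))((1+α²)f(i) − αf(i−1) − αf(i+1))` for `i ≥ 1` are well-defined
bounded linear operators, and `B` is a two-sided inverse of `T`. -/
theorem ar1_toeplitz_inverse (α : ℝ) (hα : |α| < 1) :
    ∃ T B : lp (fun _ : ℕ => ℝ) 2 →L[ℝ] lp (fun _ : ℕ => ℝ) 2,
      (∀ f : lp (fun _ : ℕ => ℝ) 2, ∀ i : ℕ,
        Summable (fun j : ℕ => α ^ ((i : ℤ) - (j : ℤ)).natAbs * f j)) ∧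
      (∀ f : lp (fun _ : ℕ => ℝ) 2, ∀ i : ℕ,
        T f i = ∑' j : ℕ, α ^ ((i : ℤ) - (j : ℤ)).natAbs * f j) ∧
      (∀ f : lp (fun _ : ℕ => ℝ) 2,
        B f 0 = (1 / (1 - α ^ 2)) * (f 0 - α * f 1)) ∧
      (∀ f : lp (fun _ : ℕ => ℝ) 2, ∀ i : ℕ, 1 ≤ i →
        B f i = (1 / (1 - α ^ 2)) * ((1 + α ^ 2) * f i - α * f (i - 1) - α * f (i + 1))) ∧
      (∀ f : lp (fun _ : ℕ => ℝ) 2, T (B f) = f ∧ B (T f) = f) := by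
  obtain ⟨u, hu⟩ := isUnit_kmsInverse hα
  have hBT (f : lp (fun _ : ℕ => ℝ) 2) : kmsInverse α (u⁻¹.val f) = f := by
    rw [← hu, ← mul_apply_eq_comp, u.mul_inv, one_apply_eq_self]
  have hTB (f : lp (fun _ : ℕ => ℝ) 2) : u⁻¹.val (kmsInverse α f) = f := by
    rw [← hu, ← mul_apply_eq_comp, u.inv_mul, one_apply_eq_self]
  refine ⟨u⁻¹.val, kmsInverse α, fun f i => (hasSum_kmsRow_mul hα f i).summable, fun f i => ?_,
    kmsInverse_apply_zero α, fun f i hi => ?_, fun f => ⟨hTB f, hBT f⟩⟩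
  · rw [(hasSum_kmsRow_mul hα f i).tsum_eq, ← inner_single_one_left i, ← kmsInverse_kmsRow hα,
      inner_kmsInverse_left, hBT]
  · obtain ⟨i, rfl⟩ := Nat.exists_eq_add_of_le' hi
    exact kmsInverse_apply_succ α f i
end

section
/- Let α, β be real numbers with |α| < 1 and |β| < 1, and let E₀ ∈ ℝ. Let T : ℓ²(ℕ, ℝ) → ℓ²(ℕ, ℝ) be the bounded operator (T f)(i) = Σ_{j ∈ ℕ} α^{|i−j|} f(j), and let E ∈ ℓ²(ℕ, ℝ) be the sequence E(n) = E₀ β^n. Then the unique solution Y ∈ ℓ²(ℕ, ℝ) of T Y = E is given by Y(0) = E₀ (1 − αβ)/(1 − α²) and Y(n) = E₀ (1 − αβ)(β − α) β^{n−1} / (1 − α²) for n ≥ 1. -/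
theorem summable_pow_succ_mul_shift {α C : ℝ} (hα : |α| < 1) {f : ℕ → ℝ} (hf : ∀ j, |f j| ≤ C)
    (m : ℕ) : Summable fun k : ℕ => α ^ (k + 1) * f (k + m) := by
  refine Summable.of_norm_bounded (g := fun k => |α| ^ k * (|α| * C))
    ((summable_geometric_of_lt_one (abs_nonneg α) hα).mul_right _) fun k => ?_
  rw [Real.norm_eq_abs, abs_mul, abs_pow, pow_succ, mul_assoc]
  gcongr
  exact hf _

theorem abs_mul_lt_one {a b : ℝ} (ha : |a| < 1) (hb : |b| < 1) : |a * b| < 1 := by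
  rw [abs_mul]
  exact mul_lt_one_of_nonneg_of_lt_one_left (abs_nonneg a) ha hb.le

/-- A bounded sequence is summable against `α ^ |i - j|` when `|α| < 1`, and the sum over `j`
splits into the part `j ≤ i` and the tail `j > i`. -/
theorem tsum_pow_natAbs_sub_mul {α C : ℝ} (hα : |α| < 1) {f : ℕ → ℝ} (hf : ∀ j, |f j| ≤ C)
    (i : ℕ) :
    ∑' j : ℕ, α ^ ((i : ℤ) - (j : ℤ)).natAbs * f j =
      ∑ j ∈ Finset.range (i + 1), α ^ (i - j) * f j + ∑' k : ℕ, α ^ (k + 1) * f (k + (i + 1)) := by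
  have htail (k : ℕ) : α ^ ((i : ℤ) - ((k + (i + 1) : ℕ) : ℤ)).natAbs * f (k + (i + 1)) =
      α ^ (k + 1) * f (k + (i + 1)) := by
    congr 2
    omega
  have hsum := summable_pow_succ_mul_shift hα hf (i + 1)
  rw [← Summable.sum_add_tsum_nat_add (i + 1)
    ((summable_nat_add_iff (i + 1)).1 (by simpa only [htail] using hsum))]
  simp only [htail]
  congr 1
  refine Finset.sum_congr rfl fun j hj => ?_
  rw [Finset.mem_range] at hj
  congr 2
  omega

/-- The causal part of the convolution with `α ^ |·|` satisfies a first-order recursion. -/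
theorem sum_range_pow_sub_mul_succ (α : ℝ) (f : ℕ → ℝ) (i : ℕ) :
    ∑ j ∈ Finset.range (i + 1 + 1), α ^ (i + 1 - j) * f j =
      α * ∑ j ∈ Finset.range (i + 1), α ^ (i - j) * f j + f (i + 1) := by
  rw [Finset.sum_range_succ, Finset.mul_sum]
  congr 1
  · refine Finset.sum_congr rfl fun j hj => ?_
    rw [Finset.mem_range] at hj
    rw [show i + 1 - j = i - j + 1 by omega]
    ring
  · simp

/-- The anticausal part of the convolution with `α ^ |·|` satisfies a first-order recursion. -/
theorem tsum_pow_succ_mul_shift {α C : ℝ} (hα : |α| < 1) {f : ℕ → ℝ} (hf : ∀ j, |f j| ≤ C)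
    (i : ℕ) :
    ∑' k : ℕ, α ^ (k + 1) * f (k + (i + 1)) =
      α * (f (i + 1) + ∑' k : ℕ, α ^ (k + 1) * f (k + (i + 1 + 1))) := by
  have hsum := summable_pow_succ_mul_shift hα hf (i + 1)
  rw [hsum.tsum_eq_zero_add, mul_add, ← tsum_mul_left]
  congr 1
  · simp
  · refine tsum_congr fun k => ?_
    rw [show k + 1 + (i + 1) = k + (i + 1 + 1) by omega]
    ring

/-- The Toeplitz matrix `α ^ |i - j|` is injective on bounded sequences. -/
theorem eq_zero_of_tsum_pow_natAbs_sub_mul_eq_zero {α C : ℝ} (hα : |α| < 1) {f : ℕ → ℝ}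
    (hf : ∀ j, |f j| ≤ C)
    (h : ∀ i : ℕ, ∑' j : ℕ, α ^ ((i : ℤ) - (j : ℤ)).natAbs * f j = 0) (n : ℕ) : f n = 0 := by
  have hα2 : 1 - α ^ 2 ≠ 0 := (sub_pos.2 ((sq_lt_one_iff_abs_lt_one α).2 hα)).ne'
  simp only [tsum_pow_natAbs_sub_mul hα hf] at h
  refine (mul_eq_zero.1 ?_).resolve_left hα2
  cases n with
  | zero =>
    have h0 := h 0
    have h1 := h 1
    have hu := sum_range_pow_sub_mul_succ α f 0
    have hv := tsum_pow_succ_mul_shift hα hf 0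
    simp only [zero_add, Finset.sum_range_one, Nat.sub_zero, pow_zero, one_mul] at h0 h1 hu hv
    linear_combination h0 - α * h1 + α * hu - hv
  | succ n =>
    have hu := sum_range_pow_sub_mul_succ α f n
    have hu' := sum_range_pow_sub_mul_succ α f (n + 1)
    have hv := tsum_pow_succ_mul_shift hα hf n
    have hv' := tsum_pow_succ_mul_shift hα hf (n + 1)
    linear_combination (1 + α ^ 2) * h (n + 1) - α * h n - α * h (n + 2) - hu + α * hu' +
      α * hv - hv'

/-- The sequence with generating function `c (1 - α z) / (1 - β z)`. -/
def ar1Seq (α β c : ℝ) : ℕ → ℝ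
  | 0 => c
  | n + 1 => c * (β - α) * β ^ n

theorem memℓp_ar1Seq (α c : ℝ) {β : ℝ} (hβ : |β| < 1) : Memℓp (ar1Seq α β c) 2 := by
  refine memℓp_gen ?_
  rw [← summable_nat_add_iff 1]
  have hβ2 : β ^ 2 < 1 := (sq_lt_one_iff_abs_lt_one β).2 hβ
  refine ((summable_geometric_of_lt_one (sq_nonneg β) hβ2).mul_left
    ((c * (β - α)) ^ 2)).congr fun n => ?_
  simp only [ar1Seq, ENNReal.toReal_ofNat, Real.rpow_ofNat, Real.norm_eq_abs, sq_abs]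
  ring

theorem sum_range_pow_sub_mul_ar1Seq (α β c : ℝ) (i : ℕ) :
    ∑ j ∈ Finset.range (i + 1), α ^ (i - j) * ar1Seq α β c j = c * β ^ i := by
  induction i with
  | zero => simp [ar1Seq]
  | succ i ih =>
    rw [sum_range_pow_sub_mul_succ, ih, ar1Seq]
    ring

theorem tsum_pow_succ_mul_ar1Seq {α β : ℝ} (c : ℝ) (hα : |α| < 1) (hβ : |β| < 1) (i : ℕ) :
    ∑' k : ℕ, α ^ (k + 1) * ar1Seq α β c (k + (i + 1)) =
      c * (β - α) * β ^ i * α / (1 - α * β) := by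
  rw [div_eq_mul_inv, ← tsum_geometric_of_abs_lt_one (abs_mul_lt_one hα hβ), ← tsum_mul_left]
  refine tsum_congr fun k => ?_
  rw [← add_assoc, ar1Seq]
  ring


/-- Let `|α| < 1`, `|β| < 1`, `E₀ ∈ ℝ`.  For the Toeplitz operator
`(T f)(i) = Σ_j α^{|i−j|} f(j)` on `ℓ²(ℕ, ℝ)` and the sequence `E(n) = E₀ β^n`, the unique
solution `Y ∈ ℓ²(ℕ, ℝ)` of `T Y = E` is `Y(0) = E₀(1 − αβ)/(1 − α²)` and
`Y(n) = E₀(1 − αβ)(β − α)β^{n−1}/(1 − α²)` for `n ≥ 1` (the paper's optimal AR(1)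
allocation, up to the factor `1/(2γ)`). -/
theorem ar1_optimal_allocation (α β E₀ : ℝ) (hα : |α| < 1) (hβ : |β| < 1)
    (T : lp (fun _ : ℕ => ℝ) 2 →L[ℝ] lp (fun _ : ℕ => ℝ) 2)
    (hT : ∀ f : lp (fun _ : ℕ => ℝ) 2, ∀ i : ℕ,
      T f i = ∑' j : ℕ, α ^ ((i : ℤ) - (j : ℤ)).natAbs * f j)
    (E : lp (fun _ : ℕ => ℝ) 2) (hE : ∀ n : ℕ, E n = E₀ * β ^ n) :
    ∃ Y : lp (fun _ : ℕ => ℝ) 2,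
      T Y = E ∧
      (∀ Y' : lp (fun _ : ℕ => ℝ) 2, T Y' = E → Y' = Y) ∧
      Y 0 = E₀ * (1 - α * β) / (1 - α ^ 2) ∧
      (∀ n : ℕ, 1 ≤ n → Y n = E₀ * (1 - α * β) * (β - α) * β ^ (n - 1) / (1 - α ^ 2)) := by
  have hα2 : 1 - α ^ 2 ≠ 0 := (sub_pos.2 ((sq_lt_one_iff_abs_lt_one α).2 hα)).ne'
  have hαβ : 1 - α * β ≠ 0 := (sub_pos.2 (abs_lt.1 (abs_mul_lt_one hα hβ)).2).ne'
  have hbdd (f : lp (fun _ : ℕ => ℝ) 2) (j : ℕ) : |f j| ≤ ‖f‖ :=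
    lp.norm_apply_le_norm two_ne_zero f j
  set c := E₀ * (1 - α * β) / (1 - α ^ 2) with hc
  let Y : lp (fun _ : ℕ => ℝ) 2 := ⟨ar1Seq α β c, memℓp_ar1Seq α c hβ⟩
  have hY : T Y = E := by
    ext i
    rw [hT, hE, tsum_pow_natAbs_sub_mul hα (hbdd Y)]
    change ∑ j ∈ Finset.range (i + 1), α ^ (i - j) * ar1Seq α β c j +
      ∑' k : ℕ, α ^ (k + 1) * ar1Seq α β c (k + (i + 1)) = _
    rw [sum_range_pow_sub_mul_ar1Seq, tsum_pow_succ_mul_ar1Seq c hα hβ, hc]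
    field_simp
    ring
  refine ⟨Y, hY, fun Y' hY' => ?_, rfl, fun n hn => ?_⟩
  · rw [← sub_eq_zero]
    ext n
    refine eq_zero_of_tsum_pow_natAbs_sub_mul_eq_zero hα (hbdd (Y' - Y)) (fun i => ?_) n
    rw [← hT, map_sub, hY, hY', sub_self]
    rfl
  · obtain ⟨m, rfl⟩ := Nat.exists_eq_add_of_le' hn
    change c * (β - α) * β ^ m = _
    rw [hc, Nat.add_sub_cancel]
    ring
end
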